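/- Let σ > 0 and let f belong sectionally to (ℰ_σ^∞)_+(ℝ²) with M = sup_{(x,y)∈ℝ²}|f(x,y)|. Then for all x₁, x₂, y₂ ∈ ℝ with x₁ ≠ x₂ and σx₂ ∉ 2πℤ, the series ∑_{n∈ℤ} [(e^{iσx₁} − 1)/(i(σx₁ − 2πn))] · [σ(f(x₂,y₂) − f(2πn/σ, y₂))/(σx₂ − 2πn)] converges absolutely and equals the divided difference (f(x₁,y₂) − f(x₂,y₂))/(x₁ − x₂) (the first factor being understood via its entire extension, with value 1, when σx₁ = 2πn). Moreover, ∑_{n∈ℤ} |e^{iσx₁} − 1|²/(σx₁ − 2πn)² = 1 and ∑_{n∈ℤ} σ²|f(x₂,y₂) − f(2πn/σ, y₂)|²/(σx₂ − 2πn)² ≤ (4/π)σ²M²; in particular the divided difference in the first variable admits a Haagerup-type factorization with constant (2/√π)σM. -/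

import Mathlib

open MeasureTheory

/-- The class `(ℰ_σ^∞)₊`: entire functions that are bounded on the closed upper half-plane
and such that `e^{-iσz} f(z)` is bounded on the closed lower half-plane (equivalently,
bounded functions on `ℝ` whose Fourier transform is supported in `[0, σ]`). -/
def MemEInftyPlus (σ : ℝ) (f : ℂ → ℂ) : Prop :=
  Differentiable ℂ f ∧
  (∃ C : ℝ, ∀ z : ℂ, 0 ≤ z.im → ‖f z‖ ≤ C) ∧
  (∃ C : ℝ, ∀ z : ℂ, z.im ≤ 0 → ‖Complex.exp (-(Complex.I * (σ : ℂ) * z)) * f z‖ ≤ C)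

/-- The factor `(e^{iσy} − 1)/(i(σy − 2πn))`, understood as the value `1` of its entire
extension when `σy = 2πn`. -/
noncomputable def sincFac (σ : ℝ) (n : ℤ) (y : ℝ) : ℂ :=
  if σ * y = 2 * Real.pi * n then 1
  else (Complex.exp (Complex.I * ((σ * y : ℝ) : ℂ)) - 1) /
    (Complex.I * (((σ * y : ℝ) : ℂ) - ((2 * Real.pi * n : ℝ) : ℂ)))

/-- `f : ℂ × ℂ → ℂ` belongs sectionally to `(ℰ_σ^∞)₊(ℝ²)`: for every `a ∈ ℝ` the
functions `z ↦ f(z, a)` and `z ↦ f(a, z)` belong to `(ℰ_σ^∞)₊`. -/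
def SectEInftyPlus (σ : ℝ) (f : ℂ → ℂ → ℂ) : Prop :=
  ∀ a : ℝ, MemEInftyPlus σ (fun z => f z (a : ℂ)) ∧ MemEInftyPlus σ (fun z => f (a : ℂ) z)


open Filter Topology Complex AddCircle

theorem Differentiable.exists_eq_mul_of_simple_zeros {H E : ℂ → ℂ} (hH : Differentiable ℂ H)
    (hE : Differentiable ℂ E) (hE' : ∀ z, E z = 0 → _root_.deriv E z ≠ 0)
    (hHE : ∀ z, E z = 0 → H z = 0) :
    ∃ Q : ℂ → ℂ, Differentiable ℂ Q ∧ ∀ z, H z = Q z * E z := by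
  classical
  refine ⟨fun z => if E z = 0 then _root_.deriv H z / _root_.deriv E z else H z / E z, fun w => ?_, fun z => ?_⟩
  · by_cases hw : E w = 0
    · have dsl {F : ℂ → ℂ} (hF : Differentiable ℂ F) : DifferentiableAt ℂ (dslope F w) w :=
        ((Complex.differentiableOn_dslope univ_mem).2 hF.differentiableOn).differentiableAt
          univ_mem
      have hne : dslope E w w ≠ 0 := by rw [dslope_same]; exact hE' w hw
      refine ((dsl hH).div (dsl hE) hne).congr_of_eventuallyEq ?_
      filter_upwards [(dsl hE).continuousAt.eventually_ne hne] with z hz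
      rcases eq_or_ne z w with rfl | hzw
      · simp [hw]
      · have hEz : E z = (z - w) * dslope E w z := by
          have := sub_smul_dslope E w z
          rw [hw, sub_zero] at this
          exact this.symm
        have hHz : H z = (z - w) * dslope H w z := by
          have := sub_smul_dslope H w z
          rw [hHE w hw, sub_zero] at this
          exact this.symm
        have h0 : z - w ≠ 0 := sub_ne_zero.2 hzw
        simp only [Pi.div_apply]
        rw [if_neg (by rw [hEz]; exact mul_ne_zero h0 hz), hEz, hHz, mul_div_mul_left _ _ h0]
    · refine ((hH w).div (hE w) hw).congr_of_eventuallyEq ?_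
      filter_upwards [(hE w).continuousAt.eventually_ne hw] with z hz
      simp [hz]
  · by_cases hz : E z = 0
    · simp [hz, hHE z hz]
    · simp [hz]

theorem norm_exp_I_mul (z : ℂ) : ‖exp (I * z)‖ = Real.exp (-z.im) := by
  simp [Complex.norm_exp]

theorem max_le_two_mul_norm_exp_I_mul_sub_one {z : ℂ}
    (hz : 1 ≤ |z.im| ∨ ∃ n : ℤ, z.re = (2 * n + 1) * Real.pi) :
    max 1 (Real.exp (-z.im)) ≤ 2 * ‖exp (I * z) - 1‖ := by
  have h2 : (2 : ℝ) ≤ Real.exp 1 := by linarith [Real.add_one_le_exp (1 : ℝ)]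
  rcases hz with hz | ⟨n, hn⟩
  · rcases le_abs.1 hz with h | h
    · have h1 : ‖(1 : ℂ)‖ - ‖exp (I * z)‖ ≤ ‖exp (I * z) - 1‖ := by
        rw [← norm_neg (exp (I * z) - 1), neg_sub]; exact norm_sub_norm_le _ _
      rw [norm_exp_I_mul, norm_one] at h1
      have h3 : Real.exp (-z.im) ≤ 1 / 2 := by
        rw [Real.exp_neg, one_div]
        exact inv_anti₀ two_pos (h2.trans (Real.exp_le_exp.2 h))
      exact max_le (by linarith) (by linarith)
    · have h1 : ‖exp (I * z)‖ - ‖(1 : ℂ)‖ ≤ ‖exp (I * z) - 1‖ := norm_sub_norm_le _ _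
      rw [norm_exp_I_mul, norm_one] at h1
      have h3 : 2 ≤ Real.exp (-z.im) := h2.trans (Real.exp_le_exp.2 h)
      exact max_le (by linarith) (by linarith)
  · have h1 : exp (I * z) = -(Real.exp (-z.im) : ℝ) := by
      have : I * z = ((-z.im : ℝ) : ℂ) + (Real.pi * I + n * (2 * Real.pi * I)) := by
        conv_lhs => rw [← re_add_im z, hn]
        push_cast
        linear_combination (z.im : ℂ) * I_mul_I
      rw [this, Complex.exp_add, Complex.exp_add, exp_int_mul_two_pi_mul_I, exp_pi_mul_I,
        ← ofReal_exp]
      ring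
    have h3 : ‖exp (I * z) - 1‖ = Real.exp (-z.im) + 1 := by
      rw [h1, ← neg_add', norm_neg]
      have : ((Real.exp (-z.im) : ℝ) : ℂ) + 1 = ((Real.exp (-z.im) + 1 : ℝ) : ℂ) := by push_cast; rfl
      rw [this, Complex.norm_real, Real.norm_eq_abs, abs_of_pos (by positivity)]
    have := Real.exp_pos (-z.im)
    rw [h3]
    exact max_le (by linarith) (by linarith)

theorem exp_I_mul_sub_one_eq_zero_iff {z : ℂ} :
    exp (I * z) - 1 = 0 ↔ ∃ n : ℤ, z = ((2 * Real.pi * n : ℝ) : ℂ) := by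
  rw [sub_eq_zero, Complex.exp_eq_one_iff]
  refine exists_congr fun n => ?_
  rw [show (n : ℂ) * (2 * Real.pi * I) = I * ((2 * Real.pi * n : ℝ) : ℂ) by push_cast; ring]
  exact mul_right_inj' I_ne_zero

theorem MemEInftyPlus.exists_norm_le {f : ℂ → ℂ} (hf : MemEInftyPlus 1 f) :
    ∃ C : ℝ, ∀ z, ‖f z‖ ≤ C * max 1 (Real.exp (-z.im)) := by
  obtain ⟨-, ⟨C, hC⟩, D, hD⟩ := hf
  refine ⟨max C D, fun z => ?_⟩
  have hC0 : 0 ≤ max C D := le_max_of_le_left ((norm_nonneg _).trans (hC 0 (by simp)))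
  rcases le_total 0 z.im with h | h
  · calc ‖f z‖ ≤ max C D * 1 := by rw [mul_one]; exact (hC z h).trans (le_max_left _ _)
      _ ≤ _ := mul_le_mul_of_nonneg_left (le_max_left _ _) hC0
  · have h1 := hD z h
    rw [ofReal_one, mul_one, Complex.exp_neg, norm_mul, norm_inv, norm_exp_I_mul,
      inv_mul_le_iff₀ (Real.exp_pos _), mul_comm] at h1
    calc ‖f z‖ ≤ D * Real.exp (-z.im) := h1
      _ ≤ max C D * Real.exp (-z.im) :=
        mul_le_mul_of_nonneg_right (le_max_right _ _) (Real.exp_pos _).le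
      _ ≤ _ := mul_le_mul_of_nonneg_left (le_max_right _ _) hC0

theorem MemEInftyPlus.sub {σ : ℝ} {f g : ℂ → ℂ} (hf : MemEInftyPlus σ f)
    (hg : MemEInftyPlus σ g) : MemEInftyPlus σ (fun z => f z - g z) := by
  obtain ⟨hfd, ⟨C, hC⟩, D, hD⟩ := hf
  obtain ⟨hgd, ⟨C', hC'⟩, D', hD'⟩ := hg
  refine ⟨hfd.sub hgd, ⟨C + C', fun z hz => norm_sub_le_of_le (hC z hz) (hC' z hz)⟩,
    D + D', fun z hz => ?_⟩
  rw [mul_sub]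
  exact norm_sub_le_of_le (hD z hz) (hD' z hz)

/-- Uniqueness in the sampling theorem: a function in `(ℰ_1^∞)₊` that vanishes on `2πℤ` is a
multiple of `e^{iz} - 1`, hence zero if it tends to `0` along the positive imaginary axis. -/
theorem MemEInftyPlus.eq_zero_of_zeros {H : ℂ → ℂ} (hH : MemEInftyPlus 1 H)
    (h0 : ∀ n : ℤ, H ((2 * Real.pi * n : ℝ) : ℂ) = 0)
    (hlim : Tendsto (fun y : ℝ => H (y * I)) atTop (𝓝 0)) (z : ℂ) : H z = 0 := by
  obtain ⟨C, hC⟩ := hH.exists_norm_le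
  have hC0 : 0 ≤ C := nonneg_of_mul_nonneg_left ((norm_nonneg _).trans (hC 0)) (by positivity)
  have hE' (z : ℂ) : HasDerivAt (fun z => exp (I * z) - 1) (exp (I * z) * I) z := by
    simpa using (((hasDerivAt_id z).const_mul I).cexp.sub_const 1)
  obtain ⟨Q, hQd, hQ⟩ := hH.1.exists_eq_mul_of_simple_zeros
    (fun z => (hE' z).differentiableAt)
    (fun z _ => by rw [(hE' z).deriv]; exact mul_ne_zero (Complex.exp_ne_zero _) I_ne_zero)
    (fun z hz => by
      obtain ⟨n, rfl⟩ := exp_I_mul_sub_one_eq_zero_iff.1 hz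
      exact h0 n)
  have hout (z : ℂ) (hz : 1 ≤ |z.im| ∨ ∃ n : ℤ, z.re = (2 * n + 1) * Real.pi) :
      ‖Q z‖ ≤ 2 * C := by
    have h1 := max_le_two_mul_norm_exp_I_mul_sub_one hz
    have hpos : 0 < ‖exp (I * z) - 1‖ := by
      have : (1 : ℝ) ≤ max 1 (Real.exp (-z.im)) := le_max_left _ _
      linarith
    refine le_of_mul_le_mul_right ?_ hpos
    calc ‖Q z‖ * ‖exp (I * z) - 1‖ = ‖H z‖ := by rw [hQ z, norm_mul]
      _ ≤ C * max 1 (Real.exp (-z.im)) := hC z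
      _ ≤ C * (2 * ‖exp (I * z) - 1‖) := mul_le_mul_of_nonneg_left h1 hC0
      _ = _ := by ring
  have hbd (z : ℂ) : ‖Q z‖ ≤ 2 * C := by
    by_cases hz : 1 ≤ |z.im|
    · exact hout z (Or.inl hz)
    have hπ := Real.pi_pos
    set n : ℤ := round (z.re / (2 * Real.pi)) with hn
    have hr := abs_le.1 (abs_sub_round (z.re / (2 * Real.pi)))
    rw [← hn] at hr
    have hre : z.re = z.re / (2 * Real.pi) * (2 * Real.pi) := by field_simp
    set a : ℝ := (2 * (n - 1 : ℤ) + 1) * Real.pi with ha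
    set b : ℝ := (2 * n + 1) * Real.pi with hb
    have hab : a < b := by rw [ha, hb]; push_cast; nlinarith
    have hcl : closure (Set.Ioo a b ×ℂ Set.Ioo (-1 : ℝ) 1) = Set.Icc a b ×ℂ Set.Icc (-1 : ℝ) 1 := by
      rw [closure_reProdIm, closure_Ioo hab.ne, closure_Ioo (by norm_num)]
    refine Complex.norm_le_of_forall_mem_frontier_norm_le
      (U := Set.Ioo a b ×ℂ Set.Ioo (-1 : ℝ) 1)
      ((Metric.isBounded_Ioo a b).reProdIm (Metric.isBounded_Ioo _ _)) hQd.diffContOnCl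
      (fun w hw => hout w ?_) ?_
    · rw [frontier_reProdIm, frontier_Ioo hab, frontier_Ioo (by norm_num)] at hw
      rcases hw with hw | hw
      · left
        rcases hw.2 with h | h
        · rw [show w.im = -1 from h]; norm_num
        · rw [show w.im = 1 from h]; norm_num
      · right
        rcases hw.1 with h | h
        · exact ⟨n - 1, h⟩
        · exact ⟨n, h⟩
    · rw [hcl]
      have := abs_le.1 (not_le.1 hz).le
      refine ⟨⟨?_, ?_⟩, this⟩
      · rw [hre, ha]; push_cast; nlinarith
      · rw [hre, hb]; nlinarith
  obtain ⟨c, hc⟩ := hQd.exists_const_forall_eq_of_bounded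
    (isBounded_iff_forall_norm_le.2 ⟨2 * C, by rintro _ ⟨z, rfl⟩; exact hbd z⟩)
  have hlim' : Tendsto (fun y : ℝ => H (y * I)) atTop (𝓝 (c * (((0 : ℝ) : ℂ) - 1))) := by
    have h1 (y : ℝ) : H (y * I) = c * (((Real.exp (-y) : ℝ) : ℂ) - 1) := by
      rw [hQ, hc, show I * (y * I) = ((-y : ℝ) : ℂ) by
        push_cast; linear_combination (y : ℂ) * I_mul_I, ofReal_exp]
    simp_rw [h1]
    exact ((continuous_ofReal.continuousAt.tendsto.comp
      (Real.tendsto_exp_neg_atTop_nhds_zero)).sub_const 1).const_mul c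
  have hc0 : c = 0 := by simpa using tendsto_nhds_unique hlim' hlim
  rw [hQ z, hc, hc0, zero_mul]



/-- The representative in `(0, 1]` of a point of the unit circle. -/
noncomputable def circleRep (t : UnitAddCircle) : ℝ := AddCircle.equivIoc 1 0 t

theorem measurable_circleRep : Measurable circleRep :=
  measurable_subtype_coe.comp (AddCircle.measurableEquivIoc 1 0).measurable

theorem circleRep_pos (t : UnitAddCircle) : 0 < circleRep t := (AddCircle.equivIoc 1 0 t).2.1

theorem circleRep_le_one (t : UnitAddCircle) : circleRep t ≤ 1 :=
  (AddCircle.equivIoc 1 0 t).2.2.trans_eq (zero_add 1)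

theorem coe_circleRep (t : UnitAddCircle) : (circleRep t : UnitAddCircle) = t :=
  AddCircle.coe_equivIoc

/-- The restriction of the exponential `s ↦ e^{izs}` to `(0, 1]`, as a function on the circle. -/
noncomputable def circleExp (z : ℂ) (t : UnitAddCircle) : ℂ := exp (I * z * circleRep t)

theorem measurable_circleExp (z : ℂ) : Measurable (circleExp z) := by
  have := measurable_circleRep
  unfold circleExp
  fun_prop

theorem norm_circleExp (z : ℂ) (t : UnitAddCircle) :
    ‖circleExp z t‖ = Real.exp (-(z.im * circleRep t)) := by
  simp [circleExp, Complex.norm_exp]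

theorem norm_circleExp_ofReal (x : ℝ) (t : UnitAddCircle) : ‖circleExp x t‖ = 1 := by
  simp [norm_circleExp]

theorem circleExp_add (z w : ℂ) (t : UnitAddCircle) :
    circleExp (z + w) t = circleExp z t * circleExp w t := by
  rw [circleExp, circleExp, circleExp, ← Complex.exp_add]
  ring_nf

theorem circleExp_two_pi_mul_int (n : ℤ) (t : UnitAddCircle) :
    circleExp ((2 * Real.pi * n : ℝ) : ℂ) t = fourier n t := by
  conv_rhs => rw [← coe_circleRep t]
  rw [fourier_coe_apply, circleExp]
  push_cast
  ring_nf

theorem integral_circleExp (z : ℂ) :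
    ∫ t, circleExp z t ∂haarAddCircle = ∫ s in (0 : ℝ)..1, exp (I * z * s) := by
  rw [AddCircle.integral_haarAddCircle, inv_one, one_smul]
  have := AddCircle.integral_liftIoc_eq_intervalIntegral (T := 1) (t := 0)
    (f := fun s : ℝ => exp (I * z * s))
  rw [zero_add] at this
  rw [← this]
  rfl

theorem integral_circleExp_eq_sincFac (σ : ℝ) (n : ℤ) (x : ℝ) :
    ∫ t, circleExp ((σ * x - 2 * Real.pi * n : ℝ) : ℂ) t ∂haarAddCircle = sincFac σ n x := by
  rw [integral_circleExp, sincFac]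
  split_ifs with h
  · simp [h]
  · have hne : I * ((σ * x - 2 * Real.pi * n : ℝ) : ℂ) ≠ 0 :=
      mul_ne_zero I_ne_zero (ofReal_ne_zero.2 (sub_ne_zero.2 h))
    have h1 : exp (I * ((σ * x - 2 * Real.pi * n : ℝ) : ℂ)) = exp (I * ((σ * x : ℝ) : ℂ)) := by
      rw [Complex.exp_eq_exp_iff_exists_int]
      exact ⟨-n, by push_cast; ring⟩
    rw [integral_exp_mul_complex hne]
    simp only [ofReal_one, mul_one, ofReal_zero, mul_zero, Complex.exp_zero, h1]
    push_cast
    rfl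

theorem memLp_circleExp (x : ℝ) : MemLp (circleExp x) 2 haarAddCircle :=
  MemLp.of_bound (measurable_circleExp _).aestronglyMeasurable 1
    (.of_forall fun t => (norm_circleExp_ofReal x t).le)

theorem hasSum_norm_fourierCoeff_sq {f : UnitAddCircle → ℂ} (hf : MemLp f 2 haarAddCircle) :
    HasSum (fun n => ‖fourierCoeff f n‖ ^ 2) (∫ t, ‖f t‖ ^ 2 ∂haarAddCircle) := by
  have h := hasSum_sq_fourierCoeff (hf.toLp f)
  simp_rw [fourierCoeff_congr_ae hf.coeFn_toLp] at h
  convert h using 1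
  refine integral_congr_ae ?_
  filter_upwards [hf.coeFn_toLp] with t ht
  rw [ht]

theorem hasSum_conj_fourierCoeff_mul_fourierCoeff {f g : UnitAddCircle → ℂ}
    (hf : MemLp f 2 haarAddCircle) (hg : MemLp g 2 haarAddCircle) :
    HasSum (fun n => star (fourierCoeff f n) * fourierCoeff g n)
      (∫ t, star (f t) * g t ∂haarAddCircle) := by
  have h := fourierBasis.hasSum_inner_mul_inner (hf.toLp f) (hg.toLp g)
  have h1 (n : ℤ) : inner ℂ (fourierBasis n) (hg.toLp g) = fourierCoeff g n := by
    rw [← fourierBasis.repr_apply_apply, fourierBasis_repr, fourierCoeff_congr_ae hg.coeFn_toLp]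
  have h2 (n : ℤ) : inner ℂ (hf.toLp f) (fourierBasis n) = star (fourierCoeff f n) := by
    rw [← inner_conj_symm, ← fourierBasis.repr_apply_apply, fourierBasis_repr,
      fourierCoeff_congr_ae hf.coeFn_toLp]
    rfl
  simp_rw [h1, h2] at h
  have h3 : inner ℂ (hf.toLp f) (hg.toLp g) = ∫ t, star (f t) * g t ∂haarAddCircle := by
    rw [L2.inner_def]
    refine integral_congr_ae ?_
    filter_upwards [hf.coeFn_toLp, hg.coeFn_toLp] with t h1 h2
    rw [h1, h2, RCLike.inner_apply']
    rfl
  rwa [h3] at h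

theorem exists_memLp_fourierCoeff_eq {c : ℤ → ℂ} (hc : Summable fun n => ‖c n‖ ^ 2) :
    ∃ φ : UnitAddCircle → ℂ, MemLp φ 2 haarAddCircle ∧ ∀ n, fourierCoeff φ n = c n := by
  have hm : Memℓp c 2 := by
    rw [memℓp_gen_iff (by norm_num)]
    simpa using hc
  refine ⟨fourierBasis.repr.symm ⟨c, hm⟩, Lp.memLp _, fun n => ?_⟩
  rw [← fourierBasis_repr, LinearIsometryEquiv.apply_symm_apply]

theorem fourierCoeff_eq_integral_circleExp (f : UnitAddCircle → ℂ) (n : ℤ) :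
    fourierCoeff f n = ∫ t, f t * circleExp (-(2 * Real.pi * n : ℝ) : ℂ) t ∂haarAddCircle := by
  rw [fourierCoeff]
  refine integral_congr_ae (.of_forall fun t => ?_)
  simp only
  rw [← circleExp_two_pi_mul_int, smul_eq_mul, mul_comm]
  push_cast
  ring_nf

theorem fourierCoeff_circleExp (σ x : ℝ) (n : ℤ) :
    fourierCoeff (circleExp (σ * x : ℝ)) n = sincFac σ n x := by
  rw [fourierCoeff_eq_integral_circleExp, ← integral_circleExp_eq_sincFac]
  simp_rw [← circleExp_add]
  push_cast
  ring_nf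

theorem hasSum_norm_sincFac_sq (σ x : ℝ) : HasSum (fun n : ℤ => ‖sincFac σ n x‖ ^ 2) 1 := by
  simpa only [fourierCoeff_circleExp, norm_circleExp_ofReal, one_pow, integral_const, probReal_univ,
    smul_eq_mul, mul_one] using hasSum_norm_fourierCoeff_sq (memLp_circleExp (σ * x))

theorem differentiable_integral_mul_circleExp {φ : UnitAddCircle → ℂ}
    (hφ : Integrable φ haarAddCircle) :
    Differentiable ℂ (fun z => ∫ t, φ t * circleExp z t ∂haarAddCircle) := by
  intro w
  have hb (z : ℂ) (hz : z ∈ Metric.ball w 1) (t : UnitAddCircle) :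
      ‖circleExp z t‖ ≤ Real.exp (‖w‖ + 1) := by
    rw [norm_circleExp]
    refine Real.exp_le_exp.2 ?_
    have h1 : |z.im| ≤ ‖w‖ + 1 := by
      refine (abs_im_le_norm z).trans ?_
      have : ‖z - w‖ < 1 := by simpa [dist_eq_norm] using hz
      linarith [norm_le_norm_add_norm_sub' z w]
    have := (abs_le.1 h1).1
    nlinarith [circleRep_pos t, circleRep_le_one t, norm_nonneg w]
  have hm (z : ℂ) : AEStronglyMeasurable (fun t => φ t * circleExp z t) haarAddCircle :=
    hφ.1.mul (measurable_circleExp z).aestronglyMeasurable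
  have hmr : Measurable fun t => (I * circleRep t : ℂ) := by
    have := measurable_circleRep
    fun_prop
  refine (hasDerivAt_integral_of_dominated_loc_of_deriv_le (s := Metric.ball w 1)
    (F' := fun z t => φ t * circleExp z t * (I * circleRep t))
    (bound := fun t => ‖φ t‖ * Real.exp (‖w‖ + 1)) (Metric.ball_mem_nhds w one_pos)
    (.of_forall hm) ?_ ?_ (.of_forall fun t z hz => ?_) (hφ.norm.mul_const _)
    (.of_forall fun t z hz => ?_)).2.differentiableAt
  · refine (hφ.norm.mul_const (Real.exp (‖w‖ + 1))).mono' (hm w) (.of_forall fun t => ?_)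
    rw [norm_mul]
    exact mul_le_mul_of_nonneg_left (hb w (Metric.mem_ball_self one_pos) t) (norm_nonneg _)
  · exact (hm w).mul hmr.aestronglyMeasurable
  · rw [norm_mul, norm_mul, norm_mul, norm_I, one_mul, Complex.norm_real, Real.norm_eq_abs,
      abs_of_pos (circleRep_pos t)]
    calc ‖φ t‖ * ‖circleExp z t‖ * circleRep t ≤ ‖φ t‖ * ‖circleExp z t‖ * 1 :=
          mul_le_mul_of_nonneg_left (circleRep_le_one t) (by positivity)
      _ ≤ _ := by
        rw [mul_one]
        exact mul_le_mul_of_nonneg_left (hb z hz t) (norm_nonneg _)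
  · have h : HasDerivAt (fun z => circleExp z t) (circleExp z t * (I * circleRep t)) z := by
      simpa [circleExp] using (((hasDerivAt_id z).const_mul I).mul_const (circleRep t : ℂ)).cexp
    simpa only [mul_assoc] using h.const_mul (φ t)

theorem memEInftyPlus_integral_mul_circleExp {φ : UnitAddCircle → ℂ}
    (hφ : Integrable φ haarAddCircle) :
    MemEInftyPlus 1 (fun z => ∫ t, φ t * circleExp z t ∂haarAddCircle) := by
  refine ⟨differentiable_integral_mul_circleExp hφ,
    ⟨∫ t, ‖φ t‖ ∂haarAddCircle, fun z hz => ?_⟩, ∫ t, ‖φ t‖ ∂haarAddCircle, fun z hz => ?_⟩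
  · refine norm_integral_le_of_norm_le hφ.norm (.of_forall fun t => ?_)
    rw [norm_mul, norm_circleExp]
    refine mul_le_of_le_one_right (norm_nonneg _) (Real.exp_le_one_iff.2 ?_)
    nlinarith [circleRep_pos t]
  · rw [← integral_const_mul]
    refine norm_integral_le_of_norm_le hφ.norm (.of_forall fun t => ?_)
    rw [norm_mul, norm_mul, norm_circleExp, mul_left_comm, Complex.norm_exp, ← Real.exp_add]
    refine mul_le_of_le_one_right (norm_nonneg _) (Real.exp_le_one_iff.2 ?_)
    simp
    nlinarith [circleRep_le_one t]

theorem tendsto_integral_mul_circleExp {φ : UnitAddCircle → ℂ} (hφ : Integrable φ haarAddCircle) :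
    Tendsto (fun y : ℝ => ∫ t, φ t * circleExp (y * I) t ∂haarAddCircle) atTop (𝓝 0) := by
  rw [show (0 : ℂ) = ∫ _ : UnitAddCircle, (0 : ℂ) ∂haarAddCircle by simp]
  refine tendsto_integral_filter_of_dominated_convergence (fun t => ‖φ t‖)
    (.of_forall fun y => hφ.1.mul (measurable_circleExp _).aestronglyMeasurable) ?_ hφ.norm
    (.of_forall fun t => ?_)
  · filter_upwards [eventually_ge_atTop 0] with y hy
    refine .of_forall fun t => ?_
    rw [norm_mul, norm_circleExp]
    refine mul_le_of_le_one_right (norm_nonneg _) (Real.exp_le_one_iff.2 ?_)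
    have := circleRep_pos t
    simp
    positivity
  · rw [tendsto_zero_iff_norm_tendsto_zero]
    simp_rw [norm_mul, norm_circleExp]
    rw [show (0 : ℝ) = ‖φ t‖ * 0 by simp]
    refine Tendsto.const_mul _ (Real.tendsto_exp_neg_atTop_nhds_zero.comp ?_)
    simpa using tendsto_id.atTop_mul_const (circleRep_pos t)

theorem MemEInftyPlus.exists_eq_integral_circleExp {h : ℂ → ℂ} (hh : MemEInftyPlus 1 h)
    (hsum : Summable fun n : ℤ => ‖h ((2 * Real.pi * n : ℝ) : ℂ)‖ ^ 2)
    (hlim : Tendsto (fun y : ℝ => h (y * I)) atTop (𝓝 0)) :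
    ∃ φ : UnitAddCircle → ℂ, MemLp φ 2 haarAddCircle ∧
      ∀ z, h z = ∫ t, φ t * circleExp z t ∂haarAddCircle := by
  obtain ⟨φ, hφ, hc⟩ := exists_memLp_fourierCoeff_eq
    (c := fun n => h ((2 * Real.pi * (-n : ℤ) : ℝ) : ℂ))
    ((Equiv.neg ℤ).summable_iff (f := fun n : ℤ => ‖h ((2 * Real.pi * n : ℝ) : ℂ)‖ ^ 2) |>.2 hsum)
  have hi : Integrable φ haarAddCircle := hφ.integrable (by norm_num)
  refine ⟨φ, hφ, fun z => sub_eq_zero.1 ((hh.sub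
    (memEInftyPlus_integral_mul_circleExp hi)).eq_zero_of_zeros (fun n => ?_) ?_ z)⟩
  · have h1 := hc (-n)
    rw [fourierCoeff_eq_integral_circleExp, neg_neg] at h1
    rw [← h1, sub_eq_zero]
    push_cast
    simp
  · simpa using hlim.sub (tendsto_integral_mul_circleExp hi)

theorem MemEInftyPlus.hasSum_sincFac_mul {h : ℂ → ℂ} (hh : MemEInftyPlus 1 h)
    (hsum : Summable fun n : ℤ => ‖h ((2 * Real.pi * n : ℝ) : ℂ)‖ ^ 2)
    (hlim : Tendsto (fun y : ℝ => h (y * I)) atTop (𝓝 0)) (σ x : ℝ) :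
    HasSum (fun n : ℤ => sincFac σ n x * h ((2 * Real.pi * n : ℝ) : ℂ)) (h ((σ * x : ℝ) : ℂ)) := by
  obtain ⟨φ, hφ, hrep⟩ := hh.exists_eq_integral_circleExp hsum hlim
  have hf : MemLp (fun t => star (circleExp (σ * x : ℝ) t)) 2 haarAddCircle :=
    (memLp_circleExp (σ * x)).star
  have key := hasSum_conj_fourierCoeff_mul_fourierCoeff hf hφ
  rw [← (Equiv.neg ℤ).hasSum_iff] at key
  convert key using 1
  · funext n
    simp only [Function.comp_apply, Equiv.neg_apply]
    congr 1
    · rw [fourierCoeff, ← integral_circleExp_eq_sincFac]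
      change _ = (starRingEnd ℂ) _
      rw [← integral_conj]
      refine integral_congr_ae (.of_forall fun t => ?_)
      simp only [smul_eq_mul, map_mul, neg_neg]
      rw [← fourier_neg, ← circleExp_two_pi_mul_int]
      simp only [← starRingEnd_apply, Complex.conj_conj]
      rw [← circleExp_add]
      push_cast
      ring_nf
    · rw [fourierCoeff_eq_integral_circleExp, hrep]
      push_cast
      simp
  · rw [hrep]
    simp only [star_star]
    exact integral_congr_ae (.of_forall fun t => mul_comm _ _)

theorem MemEInftyPlus.hasSum_norm_sq_shift {h : ℂ → ℂ} (hh : MemEInftyPlus 1 h)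
    (hsum : Summable fun n : ℤ => ‖h ((2 * Real.pi * n : ℝ) : ℂ)‖ ^ 2)
    (hlim : Tendsto (fun y : ℝ => h (y * I)) atTop (𝓝 0)) (θ : ℝ) :
    HasSum (fun n : ℤ => ‖h ((θ + 2 * Real.pi * n : ℝ) : ℂ)‖ ^ 2)
      (∑' n : ℤ, ‖h ((2 * Real.pi * n : ℝ) : ℂ)‖ ^ 2) := by
  obtain ⟨φ, hφ, hrep⟩ := hh.exists_eq_integral_circleExp hsum hlim
  have key (θ : ℝ) : HasSum (fun n : ℤ => ‖h ((θ + 2 * Real.pi * n : ℝ) : ℂ)‖ ^ 2)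
      (∫ t, ‖φ t‖ ^ 2 ∂haarAddCircle) := by
    have hf : MemLp (fun t => φ t * circleExp θ t) 2 haarAddCircle := by
      refine hφ.of_le (hφ.1.mul (measurable_circleExp _).aestronglyMeasurable)
        (.of_forall fun t => ?_)
      rw [norm_mul, norm_circleExp_ofReal, mul_one]
    have h1 := hasSum_norm_fourierCoeff_sq hf
    simp only [norm_mul, norm_circleExp_ofReal, mul_one] at h1
    rw [← (Equiv.neg ℤ).hasSum_iff] at h1
    convert h1 using 3 with n
    simp only [Function.comp_apply]
    rw [fourierCoeff_eq_integral_circleExp, hrep]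
    simp_rw [mul_assoc, ← circleExp_add]
    push_cast
    simp
  have h0 := key 0
  simp only [zero_add] at h0
  rw [h0.tsum_eq]
  exact key θ

theorem MemEInftyPlus.comp_div {σ : ℝ} (hσ : 0 < σ) {f : ℂ → ℂ} (hf : MemEInftyPlus σ f) :
    MemEInftyPlus 1 (fun z => f (z / σ)) := by
  obtain ⟨hd, ⟨C, hC⟩, D, hD⟩ := hf
  have hσ' : (σ : ℂ) ≠ 0 := ofReal_ne_zero.2 hσ.ne'
  refine ⟨by fun_prop, ⟨C, fun z hz => hC _ ?_⟩, D, fun z hz => ?_⟩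
  · rw [div_ofReal_im]; positivity
  · have := hD (z / σ) (by rw [div_ofReal_im]; exact div_nonpos_of_nonpos_of_nonneg hz hσ.le)
    rwa [mul_assoc, mul_div_cancel₀ _ hσ', ← mul_one I, mul_assoc I 1, ← ofReal_one,
      ← mul_assoc] at this

theorem MemEInftyPlus.dslope {g : ℂ → ℂ} (hg : MemEInftyPlus 1 g) (a : ℂ) :
    MemEInftyPlus 1 (_root_.dslope g a) := by
  obtain ⟨hd, ⟨C, hC⟩, D, hD⟩ := hg
  have hdd : Differentiable ℂ (_root_.dslope g a) := fun z =>
    ((Complex.differentiableOn_dslope univ_mem).2 hd.differentiableOn).differentiableAt univ_mem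
  have hout {z : ℂ} (hz : 1 ≤ ‖z - a‖) : ‖_root_.dslope g a z‖ ≤ ‖g z - g a‖ := by
    have hza : z ≠ a := by rintro rfl; simp at hz; linarith
    rw [dslope_of_ne _ hza, slope_def_field, norm_div]
    exact div_le_self (norm_nonneg _) hz
  obtain ⟨B, hB⟩ := (isCompact_closedBall a 1).exists_bound_of_continuousOn
    hdd.continuous.continuousOn
  have hin {z : ℂ} (hz : ¬ 1 ≤ ‖z - a‖) : ‖_root_.dslope g a z‖ ≤ B :=
    hB z (by rw [Metric.mem_closedBall, dist_eq_norm]; exact (not_le.1 hz).le)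
  have hexp {z : ℂ} (hz : z.im ≤ 0) : ‖exp (-(I * ((1 : ℝ) : ℂ) * z))‖ ≤ 1 := by
    rw [Complex.norm_exp, Real.exp_le_one_iff]
    simpa using hz
  refine ⟨hdd, ⟨max (C + ‖g a‖) B, fun z hz => ?_⟩, max (D + ‖g a‖) B, fun z hz => ?_⟩
  · by_cases h : 1 ≤ ‖z - a‖
    · exact le_max_of_le_left ((hout h).trans (norm_sub_le_of_le (hC z hz) le_rfl))
    · exact le_max_of_le_right (hin h)
  · rw [norm_mul]
    by_cases h : 1 ≤ ‖z - a‖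
    · refine le_max_of_le_left ((mul_le_mul_of_nonneg_left (hout h) (norm_nonneg _)).trans ?_)
      rw [← norm_mul, mul_sub]
      refine norm_sub_le_of_le (hD z hz) ?_
      rw [norm_mul]
      exact mul_le_of_le_one_left (norm_nonneg _) (hexp hz)
    · exact le_max_of_le_right
        ((mul_le_of_le_one_left (norm_nonneg _) (hexp hz)).trans (hin h))

theorem MemEInftyPlus.tendsto_dslope {g : ℂ → ℂ} (hg : MemEInftyPlus 1 g) (a : ℝ) :
    Tendsto (fun y : ℝ => _root_.dslope g a (y * I)) atTop (𝓝 0) := by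
  obtain ⟨-, ⟨C, hC⟩, -⟩ := hg
  refine squeeze_zero_norm' (a := fun y => (C + ‖g a‖) * y⁻¹) ?_ ?_
  · filter_upwards [eventually_gt_atTop 0] with y hy
    have hy' : y ≤ ‖(y * I - a : ℂ)‖ := by
      simpa [abs_of_pos hy] using abs_im_le_norm (y * I - a : ℂ)
    have hne : (y * I : ℂ) ≠ a := by
      intro h
      rw [h, sub_self, norm_zero] at hy'
      linarith
    rw [dslope_of_ne _ hne, slope_def_field, norm_div, div_eq_mul_inv]
    have h1 : ‖g (y * I) - g a‖ ≤ C + ‖g a‖ :=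
      norm_sub_le_of_le (hC _ (by simpa using hy.le)) le_rfl
    exact mul_le_mul h1 (inv_anti₀ hy hy') (by positivity) ((norm_nonneg _).trans h1)
  · simpa using tendsto_inv_atTop_zero.const_mul (C + ‖g a‖)

theorem norm_sincFac_sq_of_ne (σ x : ℝ) (n : ℤ) (h : σ * x ≠ 2 * Real.pi * n) :
    ‖sincFac σ n x‖ ^ 2 =
      ‖exp (I * ((σ * x : ℝ) : ℂ)) - 1‖ ^ 2 * ((σ * x - 2 * Real.pi * n) ^ 2)⁻¹ := by
  rw [sincFac, if_neg h, norm_div, norm_mul, norm_I, one_mul, ← ofReal_sub, Complex.norm_real,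
    Real.norm_eq_abs, div_pow, sq_abs, div_eq_mul_inv]

theorem summable_inv_sq_sub_two_pi_mul_int {a : ℝ} (ha : ∀ n : ℤ, a ≠ 2 * Real.pi * n) :
    Summable fun n : ℤ => ((a - 2 * Real.pi * n) ^ 2)⁻¹ := by
  have h := (hasSum_norm_sincFac_sq 1 a).summable
  have hne : ‖exp (I * (a : ℂ)) - 1‖ ^ 2 ≠ 0 := by
    refine pow_ne_zero _ (norm_ne_zero_iff.2 fun h0 => ?_)
    obtain ⟨n, hn⟩ := exp_I_mul_sub_one_eq_zero_iff.1 h0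
    exact ha n (ofReal_injective hn)
  refine (summable_mul_left_iff hne).1 (h.congr fun n => ?_)
  rw [norm_sincFac_sq_of_ne 1 a n (by rw [one_mul]; exact ha n), one_mul]

theorem hasSum_four_mul_inv_sq_odd_pi :
    HasSum (fun n : ℤ => 4 * ((Real.pi + 2 * Real.pi * n) ^ 2)⁻¹) 1 := by
  have h := hasSum_norm_sincFac_sq 1 Real.pi
  rw [← (Equiv.neg ℤ).hasSum_iff] at h
  convert h using 2 with n
  have hne : 1 * Real.pi ≠ 2 * Real.pi * ((-n : ℤ) : ℝ) := by
    intro h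
    have h1 : (1 : ℝ) = ((2 * -n : ℤ) : ℝ) :=
      mul_left_cancel₀ Real.pi_ne_zero (by push_cast at h ⊢; linarith)
    have h2 : (1 : ℤ) = 2 * -n := by exact_mod_cast h1
    omega
  simp only [Function.comp_apply, Equiv.neg_apply]
  rw [norm_sincFac_sq_of_ne _ _ _ hne, one_mul, mul_comm I, exp_pi_mul_I]
  norm_num

/-- The bound `∑ |h(2πn)|² ≤ M²` for the divided difference `h` at a real point of a function
bounded by `M` on the line: by shift invariance, the sample points may be moved to the odd
multiples of `π` away from the base point. -/
theorem MemEInftyPlus.tsum_norm_dslope_sq_le {g : ℂ → ℂ} (hg : MemEInftyPlus 1 g) {M : ℝ}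
    (hM : ∀ x : ℝ, ‖g x‖ ≤ M) (a : ℝ)
    (hsum : Summable fun n : ℤ => ‖_root_.dslope g a ((2 * Real.pi * n : ℝ) : ℂ)‖ ^ 2) :
    ∑' n : ℤ, ‖_root_.dslope g a ((2 * Real.pi * n : ℝ) : ℂ)‖ ^ 2 ≤ M ^ 2 := by
  have h := (hg.dslope a).hasSum_norm_sq_shift hsum (hg.tendsto_dslope a) (a + Real.pi)
  refine (hasSum_le (fun n => ?_) h (hasSum_four_mul_inv_sq_odd_pi.mul_left (M ^ 2))).trans_eq
    (mul_one _)
  have hb : ‖g ((a + Real.pi + 2 * Real.pi * n : ℝ) : ℂ) - g a‖ ≤ 2 * M := by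
    exact (norm_sub_le_of_le (hM _) (hM _)).trans_eq (two_mul M).symm
  have hne : ((a + Real.pi + 2 * Real.pi * n : ℝ) : ℂ) ≠ a := by
    intro h
    have h0 := ofReal_injective h
    have h1 : (1 : ℝ) = ((-2 * n : ℤ) : ℝ) :=
      mul_left_cancel₀ Real.pi_ne_zero (by push_cast; linarith)
    have h2 : (1 : ℤ) = -2 * n := by exact_mod_cast h1
    omega
  rw [dslope_of_ne _ hne, slope_def_field, norm_div, ← ofReal_sub, Complex.norm_real,
    Real.norm_eq_abs, div_pow, sq_abs, div_eq_mul_inv, ← mul_assoc,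
    show a + Real.pi + 2 * Real.pi * n - a = Real.pi + 2 * Real.pi * n by ring]
  refine mul_le_mul_of_nonneg_right ?_ (by positivity)
  calc _ ≤ (2 * M) ^ 2 := by gcongr
    _ = _ := by ring

/-- Haagerup-type expansion of the divided difference in the first variable: for `f`
sectionally in `(ℰ_σ^∞)₊(ℝ²)` bounded by `M`, and `x₁ ≠ x₂` with `σx₂ ∉ 2πℤ`, the series
`∑_{n∈ℤ} (e^{iσx₁} − 1)/(i(σx₁ − 2πn)) · σ(f(x₂,y₂) − f(2πn/σ, y₂))/(σx₂ − 2πn)` converges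
absolutely to `(f(x₁,y₂) − f(x₂,y₂))/(x₁ − x₂)`; moreover
`∑_{n∈ℤ} |e^{iσx₁} − 1|²/(σx₁ − 2πn)² = 1` and
`∑_{n∈ℤ} σ²|f(x₂,y₂) − f(2πn/σ, y₂)|²/(σx₂ − 2πn)² ≤ (4/π)σ²M²`, which together give a
Haagerup-type factorization with constant `(2/√π)σM`. -/
theorem divided_difference_first_variable (σ : ℝ) (hσ : 0 < σ) (f : ℂ → ℂ → ℂ)
    (hf : SectEInftyPlus σ f) (M : ℝ) (hM : ∀ x y : ℝ, ‖f (x : ℂ) (y : ℂ)‖ ≤ M)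
    (x₁ x₂ y₂ : ℝ) (hx : x₁ ≠ x₂) (hx₂ : ∀ n : ℤ, σ * x₂ ≠ 2 * Real.pi * n) :
    Summable (fun n : ℤ =>
      ‖sincFac σ n x₁ * ((σ : ℂ) * (f (x₂ : ℂ) (y₂ : ℂ) - f ((2 * Real.pi * n / σ : ℝ) : ℂ) (y₂ : ℂ)) /
          ((σ * x₂ - 2 * Real.pi * n : ℝ) : ℂ))‖) ∧
    HasSum (fun n : ℤ =>
      sincFac σ n x₁ * ((σ : ℂ) * (f (x₂ : ℂ) (y₂ : ℂ) - f ((2 * Real.pi * n / σ : ℝ) : ℂ) (y₂ : ℂ)) /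
          ((σ * x₂ - 2 * Real.pi * n : ℝ) : ℂ)))
      ((f (x₁ : ℂ) (y₂ : ℂ) - f (x₂ : ℂ) (y₂ : ℂ)) / ((x₁ : ℂ) - (x₂ : ℂ))) ∧
    HasSum (fun n : ℤ => ‖sincFac σ n x₁‖ ^ 2) 1 ∧
    ∃ S : ℝ,
      HasSum (fun n : ℤ =>
        σ ^ 2 * ‖f (x₂ : ℂ) (y₂ : ℂ) - f ((2 * Real.pi * n / σ : ℝ) : ℂ) (y₂ : ℂ)‖ ^ 2 /
          (σ * x₂ - 2 * Real.pi * n) ^ 2) S ∧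
      S ≤ (4 / Real.pi) * σ ^ 2 * M ^ 2 := by
  have hg : MemEInftyPlus 1 (fun z => f (z / σ) y₂) := (hf y₂).1.comp_div hσ
  set g : ℂ → ℂ := fun z => f (z / σ) y₂ with hgdef
  have hσ' : (σ : ℂ) ≠ 0 := ofReal_ne_zero.2 hσ.ne'
  have hg_mul (x : ℝ) : g ((σ * x : ℝ) : ℂ) = f x y₂ := by
    rw [hgdef]
    simp only
    rw [ofReal_mul, mul_div_cancel_left₀ _ hσ']
  have hg_div (n : ℤ) : g ((2 * Real.pi * n : ℝ) : ℂ) = f ((2 * Real.pi * n / σ : ℝ) : ℂ) y₂ := by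
    rw [hgdef, ofReal_div]
  have hgM (x : ℝ) : ‖g x‖ ≤ M := by
    have := hM (x / σ) y₂
    rwa [ofReal_div] at this
  set a : ℝ := σ * x₂ with ha
  have hds (n : ℤ) : dslope g a ((2 * Real.pi * n : ℝ) : ℂ) =
      (f (x₂ : ℂ) (y₂ : ℂ) - f ((2 * Real.pi * n / σ : ℝ) : ℂ) (y₂ : ℂ)) /
        ((a - 2 * Real.pi * n : ℝ) : ℂ) := by
    rw [dslope_of_ne _ (fun h => hx₂ n (ofReal_injective h).symm), slope_def_field, hg_mul, hg_div,
      ← neg_div_neg_eq, neg_sub, neg_sub, ← ofReal_sub]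
  have hsq (n : ℤ) : ‖dslope g a ((2 * Real.pi * n : ℝ) : ℂ)‖ ^ 2 =
      ‖f (x₂ : ℂ) (y₂ : ℂ) - f ((2 * Real.pi * n / σ : ℝ) : ℂ) (y₂ : ℂ)‖ ^ 2 /
        (a - 2 * Real.pi * n) ^ 2 := by
    rw [hds, norm_div, Complex.norm_real, Real.norm_eq_abs, div_pow, sq_abs]
  have hsum : Summable fun n : ℤ => ‖dslope g a ((2 * Real.pi * n : ℝ) : ℂ)‖ ^ 2 := by
    refine Summable.of_nonneg_of_le (fun n => by positivity) (fun n => ?_)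
      ((summable_inv_sq_sub_two_pi_mul_int hx₂).mul_left ((M + M) ^ 2))
    rw [hsq, div_eq_mul_inv]
    gcongr
    exact norm_sub_le_of_le (hM _ _) (hM _ _)
  have hmain : HasSum (fun n : ℤ =>
      sincFac σ n x₁ * ((σ : ℂ) * (f (x₂ : ℂ) (y₂ : ℂ) -
        f ((2 * Real.pi * n / σ : ℝ) : ℂ) (y₂ : ℂ)) / ((a - 2 * Real.pi * n : ℝ) : ℂ)))
      ((f (x₁ : ℂ) (y₂ : ℂ) - f (x₂ : ℂ) (y₂ : ℂ)) / ((x₁ : ℂ) - (x₂ : ℂ))) := by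
    have h := ((hg.dslope a).hasSum_sincFac_mul hsum (hg.tendsto_dslope a) σ x₁).mul_left (σ : ℂ)
    have hne : ((σ * x₁ : ℝ) : ℂ) ≠ a := fun h =>
      hx (mul_left_cancel₀ hσ.ne' (ofReal_injective h))
    rw [dslope_of_ne _ hne, slope_def_field, hg_mul, hg_mul, ha, ofReal_mul, ofReal_mul, ← mul_sub,
      ← mul_div_assoc, mul_div_mul_left _ _ hσ'] at h
    refine h.congr_fun fun n => ?_
    rw [← ofReal_mul, ← ha, hds]
    ring
  refine ⟨summable_norm_iff.2 hmain.summable, hmain, hasSum_norm_sincFac_sq σ x₁,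
    σ ^ 2 * ∑' n : ℤ, ‖dslope g a ((2 * Real.pi * n : ℝ) : ℂ)‖ ^ 2, ?_, ?_⟩
  · refine (hsum.hasSum.mul_left (σ ^ 2)).congr_fun fun n => ?_
    rw [hsq, mul_div_assoc]
  · have h1 := hg.tsum_norm_dslope_sq_le hgM a hsum
    have h2 : (1 : ℝ) ≤ 4 / Real.pi := by
      rw [one_le_div Real.pi_pos]
      exact Real.pi_le_four
    calc _ ≤ σ ^ 2 * M ^ 2 := by gcongr
      _ ≤ 4 / Real.pi * (σ ^ 2 * M ^ 2) := le_mul_of_one_le_left (by positivity) h2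
      _ = _ := by ring
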